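/- Under the same setup and assumptions (J1)–(J3) as for the truncated harmonic resolvent (families Ĵ^{(n)} : ℤ → ℂ^{d×d}, block operators L^{(n)} with diagonal blocks i(ω_f + kω₀)I_d − Ĵ₀^{(n)} and off-diagonal blocks −Ĵ^{(n)}_{k−ℓ} for k, ℓ ∈ {−n,…,n}, input blocks B^{(n)} with B in the k = 0 row and zeros elsewhere, R^{(n)} = (L^{(n)})^{−1} B^{(n)}), the sequence of gains σ^{(n)} = σ₁(R^{(n)}) converges to a limit σ_∞ ∈ ℝ, and for every α' with 0 < α' < α there exists C' > 0 such that |σ^{(n)} − σ_∞| ≤ C' e^{−α' n} for all n. -/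

import Mathlib

/-- The operator norm of a complex matrix induced by the Euclidean (`ℓ²`) vector norms.
This equals the largest singular value `σ₁`. -/
noncomputable def opNorm {a b : Type*} [Fintype a] [Fintype b] [DecidableEq b]
    (A : Matrix a b ℂ) : ℝ :=
  ‖LinearMap.toContinuousLinearMap (Matrix.toEuclideanLin A)‖

/-- The wavenumber `k ∈ {-n, …, n}` associated with the `j`-th block row/column. -/
def wn (n : ℕ) (j : Fin (2 * n + 1)) : ℤ := (j : ℤ) - (n : ℤ)

/-- The truncated harmonic resolvent operator `L^{(n)}`: block matrix with blocks indexed by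
wavenumbers `k, ℓ ∈ {-n, …, n}`, with diagonal blocks `i(ω_f + kω₀)I_d - Ĵ₀` and off-diagonal
blocks `-Ĵ_{k-ℓ}`. -/
noncomputable def Lop (d : ℕ) (ω₀ ωf : ℝ) (J : ℤ → Matrix (Fin d) (Fin d) ℂ) (n : ℕ) :
    Matrix (Fin (2 * n + 1) × Fin d) (Fin (2 * n + 1) × Fin d) ℂ :=
  Matrix.of fun p q =>
    (if p = q then Complex.I * ((ωf : ℂ) + (wn n p.1 : ℂ) * (ω₀ : ℂ)) else 0)
      - (J (wn n p.1 - wn n q.1)) p.2 q.2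

/-- The block input matrix `B^{(n)}`, with the block `B` in the row `k = 0` and zeros elsewhere. -/
noncomputable def Bop (d m : ℕ) (B : Matrix (Fin d) (Fin m) ℂ) (n : ℕ) :
    Matrix (Fin (2 * n + 1) × Fin d) (Fin m) ℂ :=
  Matrix.of fun p j => if wn n p.1 = 0 then B p.2 j else 0

theorem hr_sum_wn {E : Type*} [AddCommMonoid E] (n : ℕ) (F : ℤ → E) :
    ∑ j, F (wn n j) = ∑ k ∈ Finset.Icc (-(n:ℤ)) n, F k := by
  refine Finset.sum_bij (fun j _ => wn n j) ?_ ?_ ?_ ?_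
  · intro j _
    have := j.2
    simp only [wn, Finset.mem_Icc]
    omega
  · intro a _ b _ h
    simp only [wn] at h
    ext
    omega
  · intro k hk
    rw [Finset.mem_Icc] at hk
    refine ⟨⟨(k + n).toNat, by omega⟩, Finset.mem_univ _, ?_⟩
    simp only [wn]
    omega
  · intros; rfl

/-- Restriction of a sequence of blocks to the wavenumbers in `[-n, n]`. -/
noncomputable def hrEmb (d n : ℕ) (X : ℤ → EuclideanSpace ℂ (Fin d)) :
    EuclideanSpace ℂ (Fin (2 * n + 1) × Fin d) :=
  WithLp.toLp 2 fun p => X (wn n p.1) p.2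

/-- Operator associated with a matrix. -/
noncomputable def hrOp {a b : Type*} [Fintype a] [Fintype b] [DecidableEq b]
    (A : Matrix a b ℂ) : EuclideanSpace ℂ b →L[ℂ] EuclideanSpace ℂ a :=
  LinearMap.toContinuousLinearMap (Matrix.toEuclideanLin A)

theorem hrOp_apply {a b : Type*} [Fintype a] [Fintype b] [DecidableEq b]
    (A : Matrix a b ℂ) (x : EuclideanSpace ℂ b) (i : a) : hrOp A x i = ∑ j, A i j * x j := by
  simp [hrOp, Matrix.toLpLin_apply, Matrix.mulVec, dotProduct]

theorem hrOp_sub {a b : Type*} [Fintype a] [Fintype b] [DecidableEq b]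
    (A A' : Matrix a b ℂ) : hrOp (A - A') = hrOp A - hrOp A' := by
  simp [hrOp]

theorem hrOp_mul {a b c : Type*} [Fintype a] [Fintype b] [DecidableEq b] [Fintype c]
    [DecidableEq c]
    (A : Matrix a b ℂ) (A' : Matrix b c ℂ) (x : EuclideanSpace ℂ c) :
    hrOp (A * A') x = hrOp A (hrOp A' x) := by
  simp [hrOp, Matrix.toLpLin_apply]

theorem hrOp_one {a : Type*} [Fintype a] [DecidableEq a] (x : EuclideanSpace ℂ a) :
    hrOp (1 : Matrix a a ℂ) x = x := by
  simp [hrOp, Matrix.toLpLin_apply]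

theorem hrEmb_norm_sq (d n : ℕ) (X : ℤ → EuclideanSpace ℂ (Fin d)) :
    ‖hrEmb d n X‖ ^ 2 = ∑ k ∈ Finset.Icc (-(n:ℤ)) n, ‖X k‖ ^ 2 := by
  rw [← hr_sum_wn n (fun k => ‖X k‖ ^ 2), EuclideanSpace.norm_sq_eq, Fintype.sum_prod_type]
  simp only [EuclideanSpace.norm_sq_eq, hrEmb]

theorem hrEmb_norm_le (d n : ℕ) (X : ℤ → EuclideanSpace ℂ (Fin d)) :
    ‖hrEmb d n X‖ ≤ ∑ k ∈ Finset.Icc (-(n:ℤ)) n, ‖X k‖ := by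
  refine abs_le_of_sq_le_sq' ?_ (Finset.sum_nonneg fun _ _ => norm_nonneg _) |>.2
  rw [hrEmb_norm_sq]
  exact Finset.sum_sq_le_sq_sum_of_nonneg (fun _ _ => norm_nonneg _)

theorem hr_norm_le_emb (d n : ℕ) (X : ℤ → EuclideanSpace ℂ (Fin d)) (k : ℤ)
    (hk : k ∈ Finset.Icc (-(n:ℤ)) n) : ‖X k‖ ≤ ‖hrEmb d n X‖ := by
  refine abs_le_of_sq_le_sq' ?_ (norm_nonneg _) |>.2
  rw [hrEmb_norm_sq]
  exact Finset.single_le_sum (f := fun k => ‖X k‖ ^ 2) (fun _ _ => sq_nonneg _) hk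

theorem hrEmb_sub (d n : ℕ) (X Y : ℤ → EuclideanSpace ℂ (Fin d)) :
    hrEmb d n (X - Y) = hrEmb d n X - hrEmb d n Y := by
  ext p; simp [hrEmb]

theorem hrEmb_surj (d n : ℕ) (y : EuclideanSpace ℂ (Fin (2 * n + 1) × Fin d)) :
    ∃ X : ℤ → EuclideanSpace ℂ (Fin d), hrEmb d n X = y ∧
      ∀ k, k ∉ Finset.Icc (-(n:ℤ)) n → X k = 0 := by
  refine ⟨fun k => if h : k ∈ Finset.Icc (-(n:ℤ)) n then
    WithLp.toLp 2 fun i => y (⟨(k + n).toNat, by rw [Finset.mem_Icc] at h; omega⟩, i) else 0,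
    ?_, ?_⟩
  · ext ⟨j, i⟩
    have hj := j.2
    have h : wn n j ∈ Finset.Icc (-(n:ℤ)) n := by
      simp only [wn, Finset.mem_Icc]; omega
    simp only [hrEmb, h, dif_pos]
    have hj2 : (⟨(wn n j + n).toNat, by simp only [wn]; omega⟩ : Fin (2 * n + 1)) = j := by
      ext
      simp [wn]
    rw [hj2]
  · intro k hk
    simp only [hk, dif_neg, not_false_eq_true]

/-- Action of the truncated operator on block sequences. -/
noncomputable def hrT (d : ℕ) (ω₀ ωf : ℝ) (J : ℤ → Matrix (Fin d) (Fin d) ℂ) (n : ℕ)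
    (X : ℤ → EuclideanSpace ℂ (Fin d)) (k : ℤ) : EuclideanSpace ℂ (Fin d) :=
  (Complex.I * ((ωf : ℂ) + (k : ℂ) * (ω₀ : ℂ))) • X k
    - ∑ l ∈ Finset.Icc (-(n:ℤ)) n, hrOp (J (k - l)) (X l)

theorem hrT_sub (d : ℕ) (ω₀ ωf : ℝ) (J : ℤ → Matrix (Fin d) (Fin d) ℂ) (n : ℕ)
    (X Y : ℤ → EuclideanSpace ℂ (Fin d)) (k : ℤ) :
    hrT d ω₀ ωf J n (X - Y) k = hrT d ω₀ ωf J n X k - hrT d ω₀ ωf J n Y k := by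
  simp only [hrT, Pi.sub_apply, map_sub, Finset.sum_sub_distrib, smul_sub]
  abel

theorem hrOp_Lop (d : ℕ) (ω₀ ωf : ℝ) (J : ℤ → Matrix (Fin d) (Fin d) ℂ) (n : ℕ)
    (X : ℤ → EuclideanSpace ℂ (Fin d)) :
    hrOp (Lop d ω₀ ωf J n) (hrEmb d n X) = hrEmb d n (hrT d ω₀ ωf J n X) := by
  ext p
  rw [hrOp_apply]
  simp only [hrEmb, hrT, Lop, Matrix.of_apply, sub_mul, Finset.sum_sub_distrib, ite_mul, zero_mul,
    Finset.sum_ite_eq, Finset.mem_univ, if_true]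
  rw [← hr_sum_wn n (fun l => hrOp (J (wn n p.1 - l)) (X l)), Fintype.sum_prod_type]
  simp [hrOp_apply]

theorem hrOp_Bop (d m : ℕ) (B : Matrix (Fin d) (Fin m) ℂ) (n : ℕ) (u : EuclideanSpace ℂ (Fin m)) :
    hrOp (Bop d m B n) u = hrEmb d n (fun k => if k = 0 then hrOp B u else 0) := by
  ext p
  rw [hrOp_apply]
  simp only [hrEmb, Bop, Matrix.of_apply]
  split_ifs <;> simp [hrOp_apply]

theorem hr_summable (δ : ℝ) (hδ : 0 < δ) : Summable fun k : ℤ => Real.exp (-δ * |(k:ℝ)|) := by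
  have h : Summable fun n : ℕ => Real.exp (-δ * (n:ℝ)) := by
    have := Real.summable_exp_nat_mul_iff (a := -δ)
    refine (this.2 (by linarith)).congr fun n => by rw [mul_comm]
  apply Summable.of_nat_of_neg <;> simpa using h

theorem hr_sum_le (δ : ℝ) (hδ : 0 < δ) (s : Finset ℤ) (k : ℤ) :
    ∑ l ∈ s, Real.exp (-δ * |((k - l : ℤ):ℝ)|) ≤ ∑' l : ℤ, Real.exp (-δ * |(l:ℝ)|) := by
  rw [← (Equiv.subLeft k).tsum_eq (fun l : ℤ => Real.exp (-δ * |(l:ℝ)|))]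
  exact ((Equiv.subLeft k).summable_iff.2 (hr_summable δ hδ)).sum_le_tsum s
    (fun _ _ => (Real.exp_pos _).le)

/-- Exponential decay of the solution, at any rate below `β + δ`. -/
theorem hr_decay (d : ℕ) (ω₀ ωf C β δ G N : ℝ) (hω₀ : 0 < ω₀) (hC : 0 < C) (hβ : 0 < β)
    (hG : ∀ (s : Finset ℤ) (k : ℤ), ∑ l ∈ s, Real.exp (-δ * |((k - l : ℤ):ℝ)|) ≤ G)
    (K : ℕ) (hK : |ωf| + C * G < ω₀ * K) (n : ℕ)
    (J : ℤ → Matrix (Fin d) (Fin d) ℂ)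
    (hJ : ∀ k : ℤ, ‖hrOp (J k)‖ ≤ C * Real.exp (-(β + δ) * |(k : ℝ)|))
    (X : ℤ → EuclideanSpace ℂ (Fin d)) (f : EuclideanSpace ℂ (Fin d))
    (hX : ∀ k ∈ Finset.Icc (-(n:ℤ)) n, hrT d ω₀ ωf J n X k = if k = 0 then f else 0)
    (hN : ∀ k ∈ Finset.Icc (-(n:ℤ)) n, ‖X k‖ ≤ N) :
    ∀ k ∈ Finset.Icc (-(n:ℤ)) n, ‖X k‖ ≤ Real.exp (β * K) * N * Real.exp (-β * |(k:ℝ)|) := by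
  obtain ⟨k₀, hk₀, hmax⟩ := Finset.exists_max_image (Finset.Icc (-(n:ℤ)) n)
    (fun k => Real.exp (β * |(k:ℝ)|) * ‖X k‖) ⟨0, by simp⟩
  have hN0 : 0 ≤ N := (norm_nonneg _).trans (hN k₀ hk₀)
  set S := Real.exp (β * |(k₀:ℝ)|) * ‖X k₀‖ with hS
  have hS0 : 0 ≤ S := by positivity
  have hXS : ∀ l ∈ Finset.Icc (-(n:ℤ)) n, ‖X l‖ ≤ Real.exp (-β * |(l:ℝ)|) * S := by
    intro l hl
    have := hmax l hl
    calc ‖X l‖ = Real.exp (-β * |(l:ℝ)|) * (Real.exp (β * |(l:ℝ)|) * ‖X l‖) := by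
          rw [← mul_assoc, ← Real.exp_add]; simp
      _ ≤ _ := by gcongr
  have key : S ≤ Real.exp (β * K) * N := by
    by_cases hkK : |(k₀:ℝ)| ≤ K
    · rw [hS]
      have := hN k₀ hk₀
      gcongr
    · push Not at hkK
      have hne : k₀ ≠ 0 := by
        rintro rfl
        simp at hkK
        have : (0:ℝ) ≤ K := Nat.cast_nonneg K
        linarith
      have h1 := hX k₀ hk₀
      rw [if_neg hne, hrT, sub_eq_zero] at h1
      have h2 : ‖Complex.I * ((ωf : ℂ) + (k₀ : ℂ) * (ω₀ : ℂ))‖ * ‖X k₀‖ ≤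
          ∑ l ∈ Finset.Icc (-(n:ℤ)) n,
            C * Real.exp (-(β + δ) * |((k₀ - l : ℤ) : ℝ)|) * (Real.exp (-β * |(l:ℝ)|) * S) := by
        rw [← norm_smul, h1]
        refine (norm_sum_le _ _).trans (Finset.sum_le_sum fun l hl => ?_)
        exact (ContinuousLinearMap.le_opNorm _ _).trans
          (mul_le_mul (hJ _) (hXS l hl) (norm_nonneg _) (by positivity))
      have h3 : C * G < ‖Complex.I * ((ωf : ℂ) + (k₀ : ℂ) * (ω₀ : ℂ))‖ := by
        have e : Complex.I * ((ωf : ℂ) + (k₀ : ℂ) * (ω₀ : ℂ))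
            = Complex.I * ((ωf + k₀ * ω₀ : ℝ) : ℂ) := by push_cast; ring
        rw [e, norm_mul, Complex.norm_I, one_mul, Complex.norm_real, Real.norm_eq_abs]
        have h4 : |(k₀:ℝ) * ω₀| - |ωf| ≤ |ωf + k₀ * ω₀| := by
          have := abs_sub_abs_le_abs_sub ((k₀:ℝ) * ω₀) (-ωf)
          rw [abs_neg] at this
          rwa [sub_neg_eq_add, add_comm ((k₀:ℝ) * ω₀) ωf] at this
        rw [abs_mul, abs_of_pos hω₀] at h4
        have := mul_lt_mul_of_pos_left hkK hω₀
        nlinarith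
      have h5 : ‖Complex.I * ((ωf : ℂ) + (k₀ : ℂ) * (ω₀ : ℂ))‖ * S ≤ C * G * S := by
        calc _ = Real.exp (β * |(k₀:ℝ)|) *
              (‖Complex.I * ((ωf : ℂ) + (k₀ : ℂ) * (ω₀ : ℂ))‖ * ‖X k₀‖) := by rw [hS]; ring
          _ ≤ Real.exp (β * |(k₀:ℝ)|) * ∑ l ∈ Finset.Icc (-(n:ℤ)) n,
            C * Real.exp (-(β + δ) * |((k₀ - l : ℤ) : ℝ)|) * (Real.exp (-β * |(l:ℝ)|) * S) := by
              gcongr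
          _ ≤ ∑ l ∈ Finset.Icc (-(n:ℤ)) n,
              C * S * Real.exp (-δ * |((k₀ - l : ℤ) : ℝ)|) := by
              rw [Finset.mul_sum]
              refine Finset.sum_le_sum fun l _ => ?_
              have ht : |(k₀:ℝ)| ≤ |((k₀ - l : ℤ) : ℝ)| + |(l:ℝ)| := by
                have := abs_add_le ((k₀ - l : ℤ) : ℝ) (l:ℝ)
                push_cast at this ⊢
                simpa using this
              calc _ = C * S * Real.exp (β * |(k₀:ℝ)| + -(β + δ) * |((k₀ - l : ℤ) : ℝ)|
                    + -β * |(l:ℝ)|) := by rw [Real.exp_add, Real.exp_add]; ring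
                _ ≤ _ := by
                  gcongr
                  nlinarith
          _ = C * S * ∑ l ∈ Finset.Icc (-(n:ℤ)) n, Real.exp (-δ * |((k₀ - l : ℤ) : ℝ)|) := by
              rw [Finset.mul_sum]
          _ ≤ C * S * G := by
              gcongr
              exact hG _ _
          _ = _ := by ring
      have : S ≤ 0 := by
        by_contra hc
        push Not at hc
        have := mul_lt_mul_of_pos_right h3 hc
        linarith
      exact this.trans (by positivity)
  intro k hk
  calc ‖X k‖ ≤ Real.exp (-β * |(k:ℝ)|) * S := hXS k hk
    _ ≤ Real.exp (-β * |(k:ℝ)|) * (Real.exp (β * K) * N) := by gcongr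
    _ = _ := by ring

/-- Bound on the residual of the solution at level `n` in the operator at level `n'`. -/
theorem hr_residual (d : ℕ) (ω₀ ωf C γ δ G A : ℝ) (hC : 0 < C) (hγ : 0 < γ) (hδ : 0 < δ)
    (hA : 0 ≤ A)
    (hG : ∀ (s : Finset ℤ) (k : ℤ), ∑ l ∈ s, Real.exp (-δ * |((k - l : ℤ):ℝ)|) ≤ G)
    (n n' : ℕ) (hnn : n ≤ n')
    (J J' : ℤ → Matrix (Fin d) (Fin d) ℂ)
    (hJ : ∀ k : ℤ, ‖hrOp (J k)‖ ≤ C * Real.exp (-(γ + 2 * δ) * |(k : ℝ)|))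
    (hJ' : ∀ k : ℤ, ‖hrOp (J' k)‖ ≤ C * Real.exp (-(γ + 2 * δ) * |(k : ℝ)|))
    (hJJ : ∀ k : ℤ, |k| ≤ (n:ℤ) → ‖hrOp (J' k) - hrOp (J k)‖ ≤ C * Real.exp (-(γ + 2 * δ) * n))
    (X : ℤ → EuclideanSpace ℂ (Fin d)) (f : EuclideanSpace ℂ (Fin d))
    (hX : ∀ k ∈ Finset.Icc (-(n:ℤ)) n, hrT d ω₀ ωf J n X k = if k = 0 then f else 0)
    (hX0 : ∀ k, k ∉ Finset.Icc (-(n:ℤ)) n → X k = 0)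
    (hXA : ∀ k ∈ Finset.Icc (-(n:ℤ)) n, ‖X k‖ ≤ A * Real.exp (-(γ + δ) * |(k:ℝ)|)) (k : ℤ) :
    ‖(if k = 0 then f else 0) - hrT d ω₀ ωf J' n' X k‖
      ≤ 2 * C * A * G * Real.exp (-γ * n) * Real.exp (-δ * |(k:ℝ)|) := by
  have hG0 : 0 ≤ G := by simpa using hG ∅ 0
  have hT : hrT d ω₀ ωf J' n' X k = (Complex.I * ((ωf : ℂ) + (k : ℂ) * (ω₀ : ℂ))) • X k
    - ∑ l ∈ Finset.Icc (-(n:ℤ)) n, hrOp (J' (k - l)) (X l) := by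
    rw [hrT]
    congr 1
    symm
    refine Finset.sum_subset (Finset.Icc_subset_Icc (by omega) (by omega)) fun l _ hl => ?_
    rw [hX0 l hl, map_zero]
  by_cases hk : k ∈ Finset.Icc (-(n:ℤ)) n
  · have hkn : |(k:ℝ)| ≤ n := by
      rw [Finset.mem_Icc, ← abs_le] at hk
      exact_mod_cast hk
    have hn0 : (0:ℝ) ≤ n := Nat.cast_nonneg n
    have e : (if k = 0 then f else 0) - hrT d ω₀ ωf J' n' X k
        = ∑ l ∈ Finset.Icc (-(n:ℤ)) n, (hrOp (J' (k - l)) - hrOp (J (k - l))) (X l) := by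
      rw [← hX k hk, hT, hrT]
      simp only [sub_apply, Finset.sum_sub_distrib]
      abel
    have hd : ∀ j : ℤ, ‖hrOp (J' j) - hrOp (J j)‖ ≤ 2 * C * Real.exp (-(γ + 2 * δ) * n) := by
      intro j
      by_cases hj : |j| ≤ (n:ℤ)
      · refine (hJJ j hj).trans ?_
        have : 0 < C * Real.exp (-(γ + 2 * δ) * n) := by positivity
        linarith
      · have hj' : (n:ℝ) ≤ |(j:ℝ)| := by
          push Not at hj
          exact_mod_cast hj.le
        have h1 : C * Real.exp (-(γ + 2 * δ) * |(j:ℝ)|) ≤ C * Real.exp (-(γ + 2 * δ) * n) := by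
          gcongr C * Real.exp ?_
          nlinarith
        have := norm_sub_le (hrOp (J' j)) (hrOp (J j))
        linarith [hJ j, hJ' j]
    rw [e]
    calc _ ≤ ∑ l ∈ Finset.Icc (-(n:ℤ)) n, 2 * C * Real.exp (-(γ + 2 * δ) * n) *
            (A * Real.exp (-δ * |((0 - l : ℤ):ℝ)|)) := by
          refine (norm_sum_le _ _).trans (Finset.sum_le_sum fun l hl => ?_)
          refine (ContinuousLinearMap.le_opNorm _ _).trans
            (mul_le_mul (hd _) ((hXA l hl).trans ?_) (norm_nonneg _) (by positivity))
          have := abs_nonneg (l:ℝ)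
          simp only [zero_sub, Int.cast_neg, abs_neg]
          gcongr A * Real.exp ?_
          nlinarith
      _ = 2 * C * Real.exp (-(γ + 2 * δ) * n) * A *
          ∑ l ∈ Finset.Icc (-(n:ℤ)) n, Real.exp (-δ * |((0 - l : ℤ):ℝ)|) := by
          rw [Finset.mul_sum]
          exact Finset.sum_congr rfl fun _ _ => by ring
      _ ≤ 2 * C * Real.exp (-(γ + 2 * δ) * n) * A * G := by
          gcongr
          exact hG _ _
      _ = 2 * C * A * G * Real.exp (-(γ + 2 * δ) * n) := by ring
      _ ≤ 2 * C * A * G * Real.exp (-γ * n + -δ * |(k:ℝ)|) := by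
          gcongr
          nlinarith
      _ = _ := by rw [Real.exp_add]; ring
  · have hk0 : k ≠ 0 := by
      rintro rfl
      simp at hk
    have hkn : (n:ℝ) ≤ |(k:ℝ)| := by
      rw [Finset.mem_Icc, ← abs_le] at hk
      push Not at hk
      exact_mod_cast hk.le
    rw [hT, if_neg hk0, hX0 k hk, smul_zero, zero_sub, zero_sub, neg_neg]
    calc _ ≤ ∑ l ∈ Finset.Icc (-(n:ℤ)) n, C * Real.exp (-(γ + 2 * δ) * |((k - l : ℤ):ℝ)|) *
            (A * Real.exp (-(γ + δ) * |(l:ℝ)|)) := by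
          refine (norm_sum_le _ _).trans (Finset.sum_le_sum fun l hl => ?_)
          exact (ContinuousLinearMap.le_opNorm _ _).trans
            (mul_le_mul (hJ' _) (hXA l hl) (norm_nonneg _) (by positivity))
      _ ≤ ∑ l ∈ Finset.Icc (-(n:ℤ)) n, C * A * Real.exp (-(γ + δ) * |(k:ℝ)|) *
            Real.exp (-δ * |((k - l : ℤ):ℝ)|) := by
          refine Finset.sum_le_sum fun l _ => ?_
          have ht : |(k:ℝ)| ≤ |((k - l : ℤ) : ℝ)| + |(l:ℝ)| := by
            have := abs_add_le ((k - l : ℤ) : ℝ) (l:ℝ)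
            push_cast at this ⊢
            simpa using this
          calc _ = C * A * Real.exp (-(γ + 2 * δ) * |((k - l : ℤ):ℝ)| + -(γ + δ) * |(l:ℝ)|) := by
                rw [Real.exp_add]; ring
            _ ≤ C * A * Real.exp (-(γ + δ) * |(k:ℝ)| + -δ * |((k - l : ℤ):ℝ)|) := by
                gcongr C * A * Real.exp ?_
                nlinarith
            _ = _ := by rw [Real.exp_add]; ring
      _ = C * A * Real.exp (-(γ + δ) * |(k:ℝ)|) *
          ∑ l ∈ Finset.Icc (-(n:ℤ)) n, Real.exp (-δ * |((k - l : ℤ):ℝ)|) := by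
          rw [Finset.mul_sum]
      _ ≤ C * A * Real.exp (-(γ + δ) * |(k:ℝ)|) * G := by
          gcongr
          exact hG _ _
      _ = 1 * (C * A * G * Real.exp (-(γ + δ) * |(k:ℝ)|)) := by ring
      _ ≤ 2 * (C * A * G * Real.exp (-γ * n + -δ * |(k:ℝ)|)) := by
          gcongr ?_ * (C * A * G * Real.exp ?_)
          · norm_num
          · nlinarith
      _ = _ := by rw [Real.exp_add]; ring

theorem hr_opNorm_sub {E F F' : Type*} [NormedAddCommGroup E] [NormedSpace ℂ E]
    [NormedAddCommGroup F] [NormedSpace ℂ F] [NormedAddCommGroup F'] [NormedSpace ℂ F']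
    (P : E →L[ℂ] F) (Q : E →L[ℂ] F') (ε : ℝ) (hε : 0 ≤ ε)
    (h : ∀ u, |‖P u‖ - ‖Q u‖| ≤ ε * ‖u‖) : |‖P‖ - ‖Q‖| ≤ ε := by
  rw [abs_le]
  constructor
  · have : ‖Q‖ ≤ ‖P‖ + ε := Q.opNorm_le_bound (by positivity) fun u => by
      have := (abs_le.1 (h u)).1
      have := P.le_opNorm u
      rw [add_mul]; linarith
    linarith
  · have : ‖P‖ ≤ ‖Q‖ + ε := P.opNorm_le_bound (by positivity) fun u => by
      have := (abs_le.1 (h u)).2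
      have := Q.le_opNorm u
      rw [add_mul]; linarith
    linarith

theorem hr_gain_cauchy
    (d m : ℕ) (ω₀ ωf : ℝ) (hω₀ : 0 < ω₀)
    (B : Matrix (Fin d) (Fin m) ℂ) (C α M : ℝ) (hC : 0 < C) (hM : 0 < M)
    (J : ℕ → ℤ → Matrix (Fin d) (Fin d) ℂ)
    (hJ1 : ∀ n : ℕ, ∀ k : ℤ, opNorm (J n k) ≤ C * Real.exp (-α * |(k : ℝ)|))
    (hJ2 : ∀ n m' : ℕ, n ≤ m' → ∀ k : ℤ, |k| ≤ (n : ℤ) →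
      opNorm (J m' k - J n k) ≤ C * Real.exp (-α * (n : ℝ)))
    (hJ3 : ∀ n : ℕ, IsUnit (Lop d ω₀ ωf (J n) n) ∧ opNorm (Lop d ω₀ ωf (J n) n)⁻¹ ≤ M)
    (γ : ℝ) (hγ : 0 < γ) (hγα : γ < α) :
    ∃ C' : ℝ, 0 < C' ∧ ∀ n n' : ℕ, n ≤ n' →
      |opNorm ((Lop d ω₀ ωf (J n') n')⁻¹ * Bop d m B n')
        - opNorm ((Lop d ω₀ ωf (J n) n)⁻¹ * Bop d m B n)| ≤ C' * Real.exp (-γ * (n : ℝ)) := by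
  obtain ⟨δ, hδ, rfl⟩ : ∃ δ : ℝ, 0 < δ ∧ α = γ + 2 * δ := ⟨(α - γ) / 2, by linarith, by ring⟩
  obtain ⟨G, hG⟩ : ∃ G : ℝ, ∀ (s : Finset ℤ) (k : ℤ),
      ∑ l ∈ s, Real.exp (-δ * |((k - l : ℤ):ℝ)|) ≤ G := ⟨_, hr_sum_le δ hδ⟩
  have hG0 : 0 ≤ G := by simpa using hG ∅ 0
  obtain ⟨K, hK⟩ := exists_nat_gt ((|ωf| + C * G) / ω₀)
  rw [div_lt_iff₀ hω₀, mul_comm (K:ℝ)] at hK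
  have hinv : ∀ n (x), ‖x‖ ≤ M * ‖hrOp (Lop d ω₀ ωf (J n) n) x‖ := by
    intro n x
    have h1 : hrOp (Lop d ω₀ ωf (J n) n)⁻¹ (hrOp (Lop d ω₀ ωf (J n) n) x) = x := by
      rw [← hrOp_mul, Matrix.nonsing_inv_mul _ ((Matrix.isUnit_iff_isUnit_det _).1 (hJ3 n).1),
        hrOp_one]
    calc ‖x‖ = ‖hrOp (Lop d ω₀ ωf (J n) n)⁻¹ (hrOp (Lop d ω₀ ωf (J n) n) x)‖ := by rw [h1]
      _ ≤ ‖hrOp (Lop d ω₀ ωf (J n) n)⁻¹‖ * ‖hrOp (Lop d ω₀ ωf (J n) n) x‖ :=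
        ContinuousLinearMap.le_opNorm _ _
      _ ≤ _ := by
        gcongr
        exact (hJ3 n).2
  -- solutions
  have hsol : ∀ n (u : EuclideanSpace ℂ (Fin m)), ∃ X : ℤ → EuclideanSpace ℂ (Fin d),
      hrOp ((Lop d ω₀ ωf (J n) n)⁻¹ * Bop d m B n) u = hrEmb d n X ∧
      (∀ k, k ∉ Finset.Icc (-(n:ℤ)) n → X k = 0) ∧
      (∀ k ∈ Finset.Icc (-(n:ℤ)) n, hrT d ω₀ ωf (J n) n X k = if k = 0 then hrOp B u else 0) ∧
      ∀ k ∈ Finset.Icc (-(n:ℤ)) n, ‖X k‖ ≤ M * (‖hrOp B‖ * ‖u‖) := by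
    intro n u
    obtain ⟨X, hX, hX0⟩ := hrEmb_surj d n (hrOp ((Lop d ω₀ ωf (J n) n)⁻¹ * Bop d m B n) u)
    have h1 : hrEmb d n (hrT d ω₀ ωf (J n) n X) =
        hrEmb d n (fun k => if k = 0 then hrOp B u else 0) := by
      rw [← hrOp_Lop, hX, ← hrOp_mul, ← Matrix.mul_assoc,
        Matrix.mul_nonsing_inv _ ((Matrix.isUnit_iff_isUnit_det _).1 (hJ3 n).1), Matrix.one_mul, hrOp_Bop]
    refine ⟨X, hX.symm, hX0, ?_, ?_⟩
    · intro k hk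
      have h2 := hr_norm_le_emb d n
        (hrT d ω₀ ωf (J n) n X - fun k => if k = 0 then hrOp B u else 0) k hk
      rw [hrEmb_sub, h1, sub_self, norm_zero] at h2
      exact sub_eq_zero.1 (norm_le_zero_iff.1 h2)
    · intro k hk
      refine (hr_norm_le_emb d n X k hk).trans ((hinv n _).trans ?_)
      rw [hrOp_Lop, h1]
      gcongr
      refine (hrEmb_norm_le d n _).trans ?_
      rw [Finset.sum_eq_single 0 (by intro b _ hb; simp [hb]) (by simp)]
      simpa using ContinuousLinearMap.le_opNorm (hrOp B) u
  set Q : ℝ := M * (2 * C * (Real.exp ((γ + δ) * K) * (M * ‖hrOp B‖)) * G * G) with hQ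
  have hQ0 : 0 ≤ Q := by positivity
  refine ⟨Q + 1, by linarith, fun n n' hnn => ?_⟩
  refine le_trans (hr_opNorm_sub (hrOp ((Lop d ω₀ ωf (J n') n')⁻¹ * Bop d m B n'))
    (hrOp ((Lop d ω₀ ωf (J n) n)⁻¹ * Bop d m B n)) (Q * Real.exp (-γ * n)) (by positivity) ?_) ?_
  swap
  · gcongr
    linarith
  intro u
  obtain ⟨X, hX, hX0, hXT, hXN⟩ := hsol n u
  obtain ⟨X', hX', hX0', hXT', hXN'⟩ := hsol n' u
  have hdec := hr_decay d ω₀ ωf C (γ + δ) δ G (M * (‖hrOp B‖ * ‖u‖)) hω₀ hC (by linarith) hG K hK n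
    (J n) (fun k => by
      have := hJ1 n k
      rwa [show γ + 2 * δ = γ + δ + δ by ring] at this) X (hrOp B u) hXT hXN
  have hres := hr_residual d ω₀ ωf C γ δ G (Real.exp ((γ + δ) * K) * (M * (‖hrOp B‖ * ‖u‖))) hC hγ
    hδ (by positivity) hG n n' hnn (J n) (J n') (hJ1 n) (hJ1 n')
    (fun k hk => by rw [← hrOp_sub]; exact hJ2 n n' hnn k hk) X (hrOp B u) hXT hX0 hdec
  have hsame : ‖hrEmb d n X‖ = ‖hrEmb d n' X‖ := by
    rw [← sq_eq_sq₀ (norm_nonneg _) (norm_nonneg _), hrEmb_norm_sq, hrEmb_norm_sq]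
    refine Finset.sum_subset (Finset.Icc_subset_Icc (by omega) (by omega)) fun l _ hl => ?_
    rw [hX0 l hl]; simp
  rw [hX, hX', hsame]
  refine (abs_norm_sub_norm_le _ _).trans ?_
  rw [← hrEmb_sub]
  refine (hinv n' _).trans ?_
  rw [hrOp_Lop]
  calc _ ≤ M * ∑ k ∈ Finset.Icc (-(n':ℤ)) n', 2 * C *
        (Real.exp ((γ + δ) * K) * (M * (‖hrOp B‖ * ‖u‖))) * G * Real.exp (-γ * n) *
          Real.exp (-δ * |((0 - k : ℤ):ℝ)|) := by
        gcongr
        refine (hrEmb_norm_le _ _ _).trans (Finset.sum_le_sum fun k hk => ?_)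
        rw [hrT_sub, hXT' k hk]
        simpa using hres k
    _ = M * (2 * C *
        (Real.exp ((γ + δ) * K) * (M * (‖hrOp B‖ * ‖u‖))) * G * Real.exp (-γ * n) *
          ∑ k ∈ Finset.Icc (-(n':ℤ)) n', Real.exp (-δ * |((0 - k : ℤ):ℝ)|)) := by
        congr 1
        rw [Finset.mul_sum]
    _ ≤ M * (2 * C *
        (Real.exp ((γ + δ) * K) * (M * (‖hrOp B‖ * ‖u‖))) * G * Real.exp (-γ * n) * G) := by
        gcongr
        exact hG _ _
    _ = _ := by rw [hQ]; ring

/-- **Spectral convergence of the harmonic resolvent gain.**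
Under (J1)–(J3), the gains `σ^{(n)} = σ₁(R^{(n)}) = ‖(L^{(n)})⁻¹ B^{(n)}‖₂` converge to a
limit `σ_∞ ∈ ℝ`, and for every `0 < α' < α` there is `C' > 0` with
`|σ^{(n)} - σ_∞| ≤ C' e^{-α' n}` for all `n`. -/
theorem hr_gain_spectral_convergence
    (d m : ℕ) (ω₀ ωf : ℝ) (hω₀ : 0 < ω₀)
    (B : Matrix (Fin d) (Fin m) ℂ) (C α M : ℝ) (hC : 0 < C) (hα : 0 < α) (hM : 0 < M)
    (J : ℕ → ℤ → Matrix (Fin d) (Fin d) ℂ)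
    (hJ1 : ∀ n : ℕ, ∀ k : ℤ, opNorm (J n k) ≤ C * Real.exp (-α * |(k : ℝ)|))
    (hJ2 : ∀ n m' : ℕ, n ≤ m' → ∀ k : ℤ, |k| ≤ (n : ℤ) →
      opNorm (J m' k - J n k) ≤ C * Real.exp (-α * (n : ℝ)))
    (hJ3 : ∀ n : ℕ, IsUnit (Lop d ω₀ ωf (J n) n) ∧ opNorm (Lop d ω₀ ωf (J n) n)⁻¹ ≤ M) :
    ∃ σ_inf : ℝ,
      Filter.Tendsto (fun n : ℕ => opNorm ((Lop d ω₀ ωf (J n) n)⁻¹ * Bop d m B n))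
        Filter.atTop (nhds σ_inf) ∧
      ∀ α' : ℝ, 0 < α' → α' < α → ∃ C' : ℝ, 0 < C' ∧ ∀ n : ℕ,
        |opNorm ((Lop d ω₀ ωf (J n) n)⁻¹ * Bop d m B n) - σ_inf|
          ≤ C' * Real.exp (-α' * (n : ℝ)) := by
  have hc := hr_gain_cauchy d m ω₀ ωf hω₀ B C α M hC hM J hJ1 hJ2 hJ3
  set σ : ℕ → ℝ := fun n : ℕ => opNorm ((Lop d ω₀ ωf (J n) n)⁻¹ * Bop d m B n) with hσ
  have hcs : CauchySeq σ := by
    obtain ⟨C', hC', h⟩ := hc (α / 2) (by linarith) (by linarith)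
    refine cauchySeq_of_le_tendsto_0' (fun n : ℕ => C' * Real.exp (-(α / 2) * (n:ℝ))) ?_ ?_
    · intro n n' hnn
      rw [dist_comm, Real.dist_eq]
      exact h n n' hnn
    · have h1 : Filter.Tendsto (fun n : ℕ => -(α / 2) * (n:ℝ)) Filter.atTop Filter.atBot :=
        tendsto_natCast_atTop_atTop.const_mul_atTop_of_neg (by linarith)
      simpa using (Real.tendsto_exp_atBot.comp h1).const_mul C'
  obtain ⟨s, hs⟩ := cauchySeq_tendsto_of_complete hcs
  refine ⟨s, hs, fun α' h0 h1 => ?_⟩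
  obtain ⟨C', hC', h⟩ := hc α' h0 h1
  refine ⟨C', hC', fun n => ?_⟩
  have ht : Filter.Tendsto (fun n' => |σ n' - σ n|) Filter.atTop (nhds |s - σ n|) :=
    (hs.sub_const _).abs
  rw [abs_sub_comm]
  refine le_of_tendsto ht ?_
  filter_upwards [Filter.eventually_ge_atTop n] with n' hn'
  exact h n n' hn'
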